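/- Let A be a complete finitely ambiguous NBW with a fixed enumeration of its states, let w be an ω-word, and let Ḡ be the reduced run DAG of A over w. Then w ∉ L(A) if and only if Ḡ has a stable level, i.e., there exists s ≥ 1 such that every F-vertex of Ḡ at a level ≥ s is finite in Ḡ. -/

import Mathlib

open scoped Classical

/-- A nondeterministic Büchi automaton on ω-words with states `Q` over alphabet `σ`. -/
structure NBW (σ : Type) (Q : Type) where
  init : Set Q
  trans : Q → σ → Set Q
  acc : Set Q

namespace NBW

variable {σ Q : Type}

/-- `ρ` is a run of `A` on the ω-word `w`. -/
def IsRun (A : NBW σ Q) (w : ℕ → σ) (ρ : ℕ → Q) : Prop :=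
  ρ 0 ∈ A.init ∧ ∀ i, ρ (i + 1) ∈ A.trans (ρ i) (w i)

/-- `ρ` is an accepting run of `A` on `w`: it visits `A.acc` infinitely often. -/
def IsAccRun (A : NBW σ Q) (w : ℕ → σ) (ρ : ℕ → Q) : Prop :=
  A.IsRun w ρ ∧ ∀ n, ∃ m, n ≤ m ∧ ρ m ∈ A.acc

/-- The ω-language accepted by `A`. -/
def Lang (A : NBW σ Q) : Set (ℕ → σ) := {w | ∃ ρ, A.IsAccRun w ρ}

/-- `A` is complete: every state has a successor on every letter. -/
def Complete (A : NBW σ Q) : Prop := ∀ q a, (A.trans q a).Nonempty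

/-- `A` is finitely ambiguous: every accepted word has finitely many accepting runs. -/
def FinitelyAmbiguous (A : NBW σ Q) : Prop :=
  ∀ w ∈ A.Lang, {ρ | A.IsAccRun w ρ}.Finite

/-- `A` is limit deterministic with partition `(QN, QD)`. -/
def LimitDetPart (A : NBW σ Q) (QN QD : Set Q) : Prop :=
  Disjoint QN QD ∧ QN ∪ QD = Set.univ ∧ A.acc ⊆ QD ∧
    ∀ q ∈ QD, ∀ a, ∃ q' ∈ QD, A.trans q a = {q'}

/-- `A` is limit deterministic (for some partition). -/
def LimitDet (A : NBW σ Q) : Prop := ∃ QN QD, A.LimitDetPart QN QD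

end NBW

namespace NBW

variable {σ Q : Type}

/-- The set of successors of the set `S` under letter `b`. -/
def dSet (A : NBW σ Q) (S : Set Q) (b : σ) : Set Q := ⋃ q ∈ S, A.trans q b

/-- The set of states occurring at level `ℓ` of the run DAG of `A` over `w`. -/
def levelSet (A : NBW σ Q) (w : ℕ → σ) : ℕ → Set Q
  | 0 => A.init
  | ℓ + 1 => A.dSet (levelSet A w ℓ) (w ℓ)

/-- Edge of the run DAG `G` of `A` over `w` from vertex `(q, ℓ)` to vertex `(q', ℓ+1)`. -/
def GEdge (A : NBW σ Q) (w : ℕ → σ) (q : Q) (ℓ : ℕ) (q' : Q) : Prop :=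
  q ∈ A.levelSet w ℓ ∧ q' ∈ A.trans q (w ℓ)

/-- Edge of the reduced run DAG `Ḡ` of `A` over `w` (wrt the fixed enumeration given
by the linear order on `Q`) from vertex `(q, ℓ)` to vertex `(q', ℓ+1)`:
`q` is the minimal state of level `ℓ` having `q'` as a successor. -/
def RedEdge (A : NBW σ Q) [LinearOrder Q] (w : ℕ → σ) (q : Q) (ℓ : ℕ) (q' : Q) : Prop :=
  q ∈ A.levelSet w ℓ ∧ q' ∈ A.trans q (w ℓ) ∧
    ∀ p ∈ A.levelSet w ℓ, q' ∈ A.trans p (w ℓ) → q ≤ p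

/-- `γ` is an initial ω-branch of the level-indexed DAG with edge relation `E`:
`γ ℓ` is the state of the branch vertex at level `ℓ`. -/
def IsInitOmegaBranch (A : NBW σ Q) (E : Q → ℕ → Q → Prop) (γ : ℕ → Q) : Prop :=
  γ 0 ∈ A.init ∧ ∀ ℓ, E (γ ℓ) ℓ (γ (ℓ + 1))

/-- The branch `γ` is accepting: it visits `F`-vertices infinitely often. -/
def IsAcceptingBranch (A : NBW σ Q) (γ : ℕ → Q) : Prop :=
  ∀ n, ∃ m, n ≤ m ∧ γ m ∈ A.acc

/-- There is an infinite branch from vertex `(q, ℓ)` inside the sub-DAG with vertex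
predicate `P` and edge relation `E`. -/
def SubInfBranch (P : Q → ℕ → Prop) (E : Q → ℕ → Q → Prop) (q : Q) (ℓ : ℕ) : Prop :=
  ∃ γ : ℕ → Q, γ 0 = q ∧ (∀ i, P (γ i) (ℓ + i)) ∧ ∀ i, E (γ i) (ℓ + i) (γ (i + 1))

/-- Vertex `(q', ℓ')` is reachable from vertex `(q, ℓ)` inside the sub-DAG with
vertex predicate `P` and edge relation `E`. -/
def SubReach (P : Q → ℕ → Prop) (E : Q → ℕ → Q → Prop)
    (q : Q) (ℓ : ℕ) (q' : Q) (ℓ' : ℕ) : Prop :=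
  ∃ n, ∃ γ : ℕ → Q, γ 0 = q ∧ γ n = q' ∧ ℓ' = ℓ + n ∧
    (∀ i ≤ n, P (γ i) (ℓ + i)) ∧ ∀ i < n, E (γ i) (ℓ + i) (γ (i + 1))

/-- Vertex `(q, ℓ)` is `F`-free in the sub-DAG with vertex predicate `P` and edge
relation `E`: it is not finite and no `F`-vertex is reachable from it. -/
def FFreeVtx (A : NBW σ Q) (P : Q → ℕ → Prop) (E : Q → ℕ → Q → Prop)
    (q : Q) (ℓ : ℕ) : Prop :=
  SubInfBranch P E q ℓ ∧ ∀ q' ℓ', SubReach P E q ℓ q' ℓ' → q' ∉ A.acc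

/-- The pruning sequence of the DAG with vertex predicate `P0` and edge relation `E`:
odd steps remove the finite vertices, even steps remove the `F`-free vertices,
everything being evaluated in the current graph. -/
def pruneSeq (A : NBW σ Q) (E : Q → ℕ → Q → Prop) (P0 : Q → ℕ → Prop) :
    ℕ → Q → ℕ → Prop
  | 0 => P0
  | i + 1 =>
    if i % 2 = 0 then
      fun q ℓ => pruneSeq A E P0 i q ℓ ∧ SubInfBranch (pruneSeq A E P0 i) E q ℓ
    else
      fun q ℓ => pruneSeq A E P0 i q ℓ ∧ ¬ A.FFreeVtx (pruneSeq A E P0 i) E q ℓ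

end NBW

namespace NBW

theorem aux_pred {σ Q : Type} [Fintype Q] [LinearOrder Q] (A : NBW σ Q) (w : ℕ → σ)
    (ℓ : ℕ) (q : Q) (hq : q ∈ A.levelSet w (ℓ + 1)) : ∃ p, A.RedEdge w p ℓ q := by
  have hne : {p | p ∈ A.levelSet w ℓ ∧ q ∈ A.trans p (w ℓ)}.Nonempty := by
    simp only [levelSet, dSet, Set.mem_iUnion] at hq
    obtain ⟨p, hp, h⟩ := hq
    exact ⟨p, hp, h⟩
  obtain ⟨p, hp, hmin⟩ := Set.exists_min_image _ id (Set.toFinite _) hne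
  exact ⟨p, hp.1, hp.2, fun p' h1 h2 => hmin p' ⟨h1, h2⟩⟩

theorem aux_prefix {σ Q : Type} [Fintype Q] [LinearOrder Q] (A : NBW σ Q) (w : ℕ → σ)
    (ℓ : ℕ) : ∀ γ : ℕ → Q, γ ℓ ∈ A.levelSet w ℓ →
      ∃ δ : ℕ → Q, (∀ i, ℓ ≤ i → δ i = γ i) ∧ δ 0 ∈ A.init ∧
        ∀ i < ℓ, A.RedEdge w (δ i) i (δ (i + 1)) := by
  induction ℓ with
  | zero => exact fun γ h => ⟨γ, fun _ _ => rfl, h, fun i hi => absurd hi (by omega)⟩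
  | succ ℓ ih =>
    intro γ h
    obtain ⟨p, hp⟩ := aux_pred A w ℓ _ h
    obtain ⟨δ, h1, h2, h3⟩ := ih (Function.update γ ℓ p) (by simpa using hp.1)
    have h4 : ∀ i, ℓ + 1 ≤ i → δ i = γ i := by
      intro i hi
      rw [h1 i (by omega), Function.update_of_ne (by omega)]
    refine ⟨δ, h4, h2, fun i hi => ?_⟩
    rcases Nat.lt_succ_iff_lt_or_eq.1 hi with hi | rfl
    · exact h3 i hi
    · rw [h4 _ le_rfl, h1 i le_rfl, Function.update_self]
      exact hp

theorem aux_level {σ Q : Type} (A : NBW σ Q) (w : ℕ → σ) (ρ : ℕ → Q) (h : A.IsRun w ρ) :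
    ∀ ℓ, ρ ℓ ∈ A.levelSet w ℓ := by
  intro ℓ
  induction ℓ with
  | zero => exact h.1
  | succ ℓ ih =>
    simp only [levelSet, dSet, Set.mem_iUnion]
    exact ⟨ρ ℓ, ih, h.2 ℓ⟩

theorem aux_back {σ Q : Type} [LinearOrder Q] (A : NBW σ Q) (w : ℕ → σ) (γ δ : ℕ → Q)
    (hγ : ∀ i, A.RedEdge w (γ i) i (γ (i + 1))) (hδ : ∀ i, A.RedEdge w (δ i) i (δ (i + 1)))
    (k d : ℕ) : γ (k + d) = δ (k + d) → γ k = δ k := by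
  induction d with
  | zero => exact id
  | succ d ih =>
    intro h
    apply ih
    have a := hγ (k + d)
    have b := hδ (k + d)
    rw [← add_assoc] at h
    rw [h] at a
    exact le_antisymm (a.2.2 _ b.1 b.2.1) (b.2.2 _ a.1 a.2.1)

theorem aux_finite {σ Q : Type} [Fintype Q] [LinearOrder Q] (A : NBW σ Q) (w : ℕ → σ) :
    {γ : ℕ → Q | ∀ i, A.RedEdge w (γ i) i (γ (i + 1))}.Finite := by
  by_contra hinf
  obtain ⟨t, ht, hcard⟩ := Set.Infinite.exists_subset_card_eq hinf (Fintype.card Q + 1)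
  have h : ∀ᶠ N in Filter.atTop, ∀ γ ∈ t, ∀ δ ∈ t, γ N = δ N → γ = δ := by
    rw [Filter.eventually_all_finset]
    intro γ hγ
    rw [Filter.eventually_all_finset]
    intro δ hδ
    by_cases he : γ = δ
    · exact Filter.Eventually.of_forall fun _ _ => he
    · obtain ⟨k, hk⟩ := Function.ne_iff.1 he
      filter_upwards [Filter.eventually_ge_atTop k] with N hN h
      obtain ⟨d, rfl⟩ := Nat.exists_eq_add_of_le hN
      exact absurd (aux_back A w γ δ (ht hγ) (ht hδ) k d h) hk
  obtain ⟨N, hN⟩ := h.exists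
  have := Finset.card_le_card_of_injOn (s := t) (t := Finset.univ) (fun γ => γ N)
    (fun _ _ => Finset.mem_coe.2 (Finset.mem_univ _)) (fun γ hγ δ hδ => hN γ hγ δ hδ)
  rw [hcard, Finset.card_univ] at this
  omega

end NBW

/-- Stable level of the reduced run DAG: for a complete FANBW `A`, `w ∉ L(A)` iff
there exists `s ≥ 1` such that every `F`-vertex of `Ḡ` at a level `≥ s` is finite. -/
theorem NBW.reduced_dag_stable_level (σ Q : Type) [Fintype σ] [Nonempty σ]
    [Fintype Q] [LinearOrder Q] (A : NBW σ Q)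
    (hc : A.Complete) (hfa : A.FinitelyAmbiguous) (w : ℕ → σ) :
    w ∉ A.Lang ↔
      ∃ s : ℕ, 1 ≤ s ∧ ∀ ℓ, s ≤ ℓ → ∀ q ∈ A.levelSet w ℓ, q ∈ A.acc →
        ¬ ∃ γ : ℕ → Q, γ 0 = q ∧ ∀ i, A.RedEdge w (γ i) (ℓ + i) (γ (i + 1)) := by
  constructor
  · intro hw
    have key : ∀ᶠ m in Filter.atTop,
        ∀ γ ∈ {γ : ℕ → Q | ∀ i, A.RedEdge w (γ i) i (γ (i + 1))},
          γ 0 ∈ A.init → γ m ∉ A.acc := by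
      rw [Filter.eventually_all_finite (NBW.aux_finite A w)]
      intro γ hγ
      by_contra hcon
      apply hw
      rw [Filter.eventually_atTop] at hcon
      push Not at hcon
      refine ⟨γ, ⟨(hcon 0).choose_spec.2.1, fun i => (hγ i).2.1⟩, fun n => ?_⟩
      obtain ⟨m, h1, _, h2⟩ := hcon n
      exact ⟨m, h1, h2⟩
    obtain ⟨s, hs⟩ := Filter.eventually_atTop.1 key
    refine ⟨s + 1, by omega, ?_⟩
    rintro ℓ hℓ q hq hacc ⟨γ, h0, hγ⟩
    obtain ⟨δ, h1, h2, h3⟩ := NBW.aux_prefix A w ℓ (fun i => γ (i - ℓ)) (by simpa [h0] using hq)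
    refine hs ℓ (by omega) δ (fun i => ?_) h2 ?_
    · rcases lt_or_ge i ℓ with hi | hi
      · exact h3 i hi
      · obtain ⟨d, rfl⟩ := Nat.exists_eq_add_of_le hi
        have := hγ d
        rw [h1 _ hi, h1 _ (by omega)]
        simpa [add_assoc] using this
    · rw [h1 ℓ le_rfl]
      simpa [h0] using hacc
  · rintro ⟨s, -, hs⟩ hw
    have hfin := hfa w hw
    obtain ⟨ρ, hρ, hacc⟩ := hw
    have hlev := NBW.aux_level A w ρ hρ
    have key : ∀ᶠ ℓ in Filter.atTop, ∀ r ∈ {ρ | A.IsAccRun w ρ},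
        ¬ (r ℓ ≠ ρ ℓ ∧ ∀ i, ℓ + 1 ≤ i → r i = ρ i) := by
      rw [Filter.eventually_all_finite hfin]
      intro r _
      by_cases h : ∃ k, ∀ i, k + 1 ≤ i → r i = ρ i
      · obtain ⟨k, hk⟩ := h
        filter_upwards [Filter.eventually_ge_atTop (k + 1)] with ℓ hℓ hcon
        exact hcon.1 (hk ℓ hℓ)
      · exact Filter.Eventually.of_forall fun ℓ hcon => h ⟨ℓ, hcon.2⟩
    obtain ⟨N, hN⟩ := Filter.eventually_atTop.1 key
    have hred : ∀ ℓ, N ≤ ℓ → A.RedEdge w (ρ ℓ) ℓ (ρ (ℓ + 1)) := by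
      intro ℓ hℓ
      refine ⟨hlev ℓ, hρ.2 ℓ, fun p hp hpt => ?_⟩
      by_contra hlt
      have hne : p ≠ ρ ℓ := fun h => hlt h.ge
      obtain ⟨δ, h1, h2, h3⟩ := NBW.aux_prefix A w ℓ (Function.update ρ ℓ p) (by simpa using hp)
      have hδℓ : δ ℓ = p := by rw [h1 ℓ le_rfl, Function.update_self]
      have h4 : ∀ i, ℓ + 1 ≤ i → δ i = ρ i := by
        intro i hi
        rw [h1 i (by omega), Function.update_of_ne (by omega)]
      refine hN ℓ hℓ δ ⟨⟨h2, fun i => ?_⟩, fun n => ?_⟩ ⟨by rwa [hδℓ], h4⟩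
      · rcases lt_trichotomy i ℓ with hi | rfl | hi
        · exact (h3 i hi).2.1
        · rw [hδℓ, h4 _ le_rfl]
          exact hpt
        · rw [h4 i hi, h4 _ (by omega)]
          exact hρ.2 i
      · obtain ⟨m, hm, hm2⟩ := hacc (max n (ℓ + 1))
        refine ⟨m, le_trans (le_max_left _ _) hm, ?_⟩
        rw [h4 m (le_trans (le_max_right _ _) hm)]
        exact hm2
    obtain ⟨m, hm, hm2⟩ := hacc (max s N)
    refine hs m (le_trans (le_max_left _ _) hm) (ρ m) (hlev m) hm2 ⟨fun i => ρ (m + i), rfl, fun i => ?_⟩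
    exact hred (m + i) (le_trans (le_trans (le_max_right _ _) hm) (Nat.le_add_right _ _))
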